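/- The map ψ : D → P(F) defined by ψ(f) = {1} ∪ { x_1⁻¹ f(x_1) x_2⁻¹ f(x_1x_2) ⋯ x_{r-1}⁻¹ f(x_1⋯x_{r-1}) x_r⁻¹ : r ≥ 1, x_1⋯x_r ∈ Ω_r(f) } ∪ { x_1⁻¹ f(x_1) x_2⁻¹ f(x_1x_2) ⋯ x_r⁻¹ f(x_1⋯x_r) : r ≥ 1, x_1⋯x_r ∈ Ω_r(f) } — where Ω_r(f) = {x_1⋯x_r ∈ E^r : x_{j+1} ≠ f(x_1⋯x_j) for j = 1,…,r−1} and each letter of E is identified with the corresponding generator of F — is a bijection of D onto Y^u, and it is a homeomorphism from D onto Y^u (each with its subspace topology). -/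

import Mathlib

/-- The free group on `m + n` generators `a_1, …, a_n, b_1, …, b_m`. -/
abbrev F (n m : ℕ) : Type := FreeGroup (Fin n ⊕ Fin m)

/-- The generator `a_i`. -/
def a {n m : ℕ} (i : Fin n) : F n m := FreeGroup.of (Sum.inl i)

/-- The generator `b_j`. -/
def b {n m : ℕ} (j : Fin m) : F n m := FreeGroup.of (Sum.inr j)

/-- The translate `g ξ = {g h : h ∈ ξ}`, for subsets of `F n m` encoded as
boolean-valued functions: `(g ξ)(k) = ξ(g⁻¹ k)`. -/
def transl {n m : ℕ} (g : F n m) (ξ : F n m → Bool) : F n m → Bool :=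
  fun k => ξ (g⁻¹ * k)

/-- `ξ` is convex. -/
def IsConvexCfg {n m : ℕ} (ξ : F n m → Bool) : Prop :=
  ∀ g h k : F n m, ξ g = true → ξ h = true →
    (g⁻¹ * k).norm + (k⁻¹ * h).norm = (g⁻¹ * h).norm → ξ k = true

/-- `ξ` has pattern (c1) at `g`. -/
def PatternC1 {n m : ℕ} (ξ : F n m → Bool) (g : F n m) : Prop :=
  (∃! i : Fin n, ξ (g * a i) = true) ∧ (∃! j : Fin m, ξ (g * b j) = true) ∧
  (∀ i : Fin n, ξ (g * (a i)⁻¹) = false) ∧ (∀ j : Fin m, ξ (g * (b j)⁻¹) = false)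

/-- `ξ` has pattern (c2) at `g`. -/
def PatternC2 {n m : ℕ} (ξ : F n m → Bool) (g : F n m) : Prop :=
  (∀ i : Fin n, ξ (g * a i) = false) ∧ (∀ j : Fin m, ξ (g * b j) = false) ∧
  (∀ i : Fin n, ξ (g * (a i)⁻¹) = true) ∧ (∀ j : Fin m, ξ (g * (b j)⁻¹) = true)

/-- The universal configuration space `Ω^u`, as a subset of the product space
`{0,1}^F` (encoded as `F n m → Bool` with the product topology). -/
def Omega (n m : ℕ) : Set (F n m → Bool) :=
  {ξ | ξ 1 = true ∧ IsConvexCfg ξ ∧ ∀ g : F n m, ξ g = true → (PatternC1 ξ g ∨ PatternC2 ξ g)}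

/-- `Y^u`: the configurations with pattern (c2) at `1`. -/
def Yu (n m : ℕ) : Set (F n m → Bool) :=
  {ξ | ξ ∈ Omega n m ∧ (∀ i : Fin n, ξ (a i)⁻¹ = true) ∧ (∀ j : Fin m, ξ (b j)⁻¹ = true)}

/-- `X^u = Ω^u \ Y^u`. -/
def Xu (n m : ℕ) : Set (F n m → Bool) := Omega n m \ Yu n m

/-- The alphabet `E = Z_0 ⊔ Z_1`, with `Z_0 = {a_1,…,a_n}` and `Z_1 = {b_1,…,b_m}`. -/
abbrev E (n m : ℕ) : Type := Fin n ⊕ Fin m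

/-- `E^+`: nonempty finite words over `E`. -/
abbrev Word (n m : ℕ) : Type := {l : List (E n m) // l ≠ []}

theorem ne_nil_append_singleton {γ : Type*} (α : List γ) (e : γ) : α ++ [e] ≠ [] := by
  simp

theorem ne_nil_append {γ : Type*} (α : List γ) {β : List γ} (hβ : β ≠ []) :
    α ++ β ≠ [] := by
  simp [hβ]

/-- `e` has the color prescribed for words ending as `w` does: `e ∈ Z_{c(w)}`,
i.e. `e` lies on the opposite side of the sum from the last letter of `w`. -/
def colorOK {n m : ℕ} (w : Word n m) (e : E n m) : Prop :=
  e.isLeft = !(w.1.getLast w.2).isLeft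

/-- The space `Z = ∏_{α ∈ E^+} Z_{c(α)}` of color-respecting functions `E^+ → E`. -/
def Zset (n m : ℕ) : Set (Word n m → E n m) :=
  {f | ∀ w : Word n m, colorOK w (f w)}

/-- Condition (*): `f(α e f(α e)) = e`. -/
def starCond {n m : ℕ} (f : Word n m → E n m) : Prop :=
  ∀ (α : List (E n m)) (e : E n m),
    f ⟨(α ++ [e]) ++ [f ⟨α ++ [e], ne_nil_append_singleton α e⟩],
        ne_nil_append_singleton _ _⟩ = e

/-- Condition (**): `f(α e f(α e) β) = f(α β)`. -/
def starStarCond {n m : ℕ} (f : Word n m → E n m) : Prop :=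
  ∀ (α : List (E n m)) (e : E n m) (β : Word n m),
    f ⟨((α ++ [e]) ++ [f ⟨α ++ [e], ne_nil_append_singleton α e⟩]) ++ β.1,
        ne_nil_append _ β.2⟩
      = f ⟨α ++ β.1, ne_nil_append _ β.2⟩

/-- The subspace `D ⊆ Z` of functions satisfying (*) and (**). -/
def Dset (n m : ℕ) : Set (Word n m → E n m) :=
  {f | f ∈ Zset n m ∧ starCond f ∧ starStarCond f}

theorem take_ne_nil {γ : Type*} (l : List γ) (k : ℕ) (hk : 0 < k) (hl : l ≠ []) :
    l.take k ≠ [] := by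
  cases l with
  | nil => exact absurd rfl hl
  | cons x xs =>
    cases k with
    | zero => omega
    | succ k => simp

/-- `Ω_r(F)`, for all `r` at once: the words `x_1 ⋯ x_r` such that
`x_{k+1} ≠ F(x_1 ⋯ x_k)` for `k = 1, …, r-1`. -/
def EOmega {n m : ℕ} (F : Word n m → E n m) : Set (Word n m) :=
  {w | ∀ (k : ℕ) (hk0 : 0 < k) (hk : k < w.1.length),
        w.1.get ⟨k, hk⟩ ≠ F ⟨w.1.take k, take_ne_nil w.1 k hk0 w.2⟩}

/-- An `E`-function, encoded as a (total) function on words whose defining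
color condition is imposed on the sets `Ω_r`. -/
def IsEFunction {n m : ℕ} (F : Word n m → E n m) : Prop :=
  ∀ w ∈ EOmega F, colorOK w (F w)

/-- A partial `E`-function `(Ω_1,f_1),…,(Ω_r,f_r)`, encoded as a (total)
function on words whose defining color condition is imposed on the words of
`Ω_1, …, Ω_r`, i.e. on words of length at most `r`. -/
def IsPartialEFunction {n m : ℕ} (r : ℕ) (F : Word n m → E n m) : Prop :=
  1 ≤ r ∧ ∀ w ∈ EOmega F, w.1.length ≤ r → colorOK w (F w)

/-- Auxiliary product: `fullAux f pre [x_1,…,x_r]` is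
`x_1⁻¹ f(pre x_1) x_2⁻¹ f(pre x_1 x_2) ⋯ x_r⁻¹ f(pre x_1 ⋯ x_r)`, each letter of
`E` being identified with the corresponding generator of `F`. -/
def fullAux {n m : ℕ} (f : Word n m → E n m) :
    List (E n m) → List (E n m) → F n m
  | _, [] => 1
  | pre, e :: rest =>
      (FreeGroup.of e)⁻¹ *
        FreeGroup.of (f ⟨pre ++ [e], ne_nil_append_singleton pre e⟩) *
        fullAux f (pre ++ [e]) rest

/-- The configuration `ψ(f) ⊆ F` associated to `f : E^+ → E`:
`ψ(f) = {1} ∪ {x_1⁻¹ f(x_1) ⋯ x_{r-1}⁻¹ f(x_1⋯x_{r-1}) x_r⁻¹ : x_1⋯x_r ∈ Ω_r(f)}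
∪ {x_1⁻¹ f(x_1) ⋯ x_r⁻¹ f(x_1⋯x_r) : x_1⋯x_r ∈ Ω_r(f)}`. -/
def psiSet {n m : ℕ} (f : Word n m → E n m) : Set (F n m) :=
  {1} ∪ {g | ∃ w ∈ EOmega f,
      g = fullAux f [] w.1.dropLast * (FreeGroup.of (w.1.getLast w.2))⁻¹ ∨
      g = fullAux f [] w.1}

/-- `ψ(f)`, as a boolean-valued function (an element of `{0,1}^F`). -/
noncomputable def psiB {n m : ℕ} (f : Word n m → E n m) : F n m → Bool :=
  fun g => @decide (g ∈ psiSet f) (Classical.propDecidable _)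

section CommonPrefix

variable {γ : Type*} [DecidableEq γ]

/-- The length of the longest common prefix of two lists. -/
def commonPrefixLength : List γ → List γ → ℕ
  | x :: xs, y :: ys => if x = y then commonPrefixLength xs ys + 1 else 0
  | [], _ => 0
  | _ :: _, [] => 0

theorem isPrefix_of_length_le_commonPrefixLength {l l' : List γ}
    (h : l.length ≤ commonPrefixLength l l') : l <+: l' := by
  induction l generalizing l' with
  | nil => simp
  | cons x xs ih =>
    cases l' with
    | nil => simp [commonPrefixLength] at h
    | cons y ys =>
      by_cases hxy : x = y
      · subst hxy
        simp only [commonPrefixLength, if_true, List.length_cons] at h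
        simpa using ih (by omega)
      · simp [commonPrefixLength, hxy] at h

theorem commonPrefixLength_comm (l l' : List γ) :
    commonPrefixLength l l' = commonPrefixLength l' l := by
  induction l generalizing l' with
  | nil => cases l' <;> simp [commonPrefixLength]
  | cons x xs ih =>
    cases l' with
    | nil => simp [commonPrefixLength]
    | cons y ys => simp [commonPrefixLength, ih ys, eq_comm]

theorem min_commonPrefixLength_le (l₁ l₂ l₃ : List γ) :
    min (commonPrefixLength l₁ l₂) (commonPrefixLength l₂ l₃) ≤ commonPrefixLength l₁ l₃ := by
  induction l₂ generalizing l₁ l₃ with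
  | nil => cases l₁ <;> simp [commonPrefixLength]
  | cons y ys ih =>
    cases l₁ with
    | nil => simp [commonPrefixLength]
    | cons x xs =>
      cases l₃ with
      | nil => simp [commonPrefixLength]
      | cons z zs =>
        have := ih xs zs
        by_cases hxy : x = y <;> by_cases hyz : y = z <;> simp_all [commonPrefixLength]

end CommonPrefix

section FreeGroupNorm

variable {γ : Type*}

theorem FreeGroup.isReduced_concat_iff {L : List (γ × Bool)} {s t : γ × Bool} :
    FreeGroup.IsReduced (L ++ [s] ++ [t]) ↔
      FreeGroup.IsReduced (L ++ [s]) ∧ (s.1 = t.1 → s.2 = t.2) := by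
  rw [FreeGroup.IsReduced, List.isChain_append]
  simp [FreeGroup.IsReduced]

variable [DecidableEq γ]

theorem FreeGroup.toWord_mk_of_isReduced {L : List (γ × Bool)} (h : FreeGroup.IsReduced L) :
    (FreeGroup.mk L).toWord = L := by
  rw [FreeGroup.toWord_mk, h.reduce_eq]

theorem FreeGroup.norm_inv_mk_mul_mk {L₁ L₂ : List (γ × Bool)} (h₁ : FreeGroup.IsReduced L₁)
    (h₂ : FreeGroup.IsReduced L₂) :
    ((FreeGroup.mk L₁)⁻¹ * FreeGroup.mk L₂).norm + 2 * commonPrefixLength L₁ L₂ =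
      L₁.length + L₂.length := by
  induction L₁ generalizing L₂ with
  | nil =>
    simp [← FreeGroup.one_eq_mk, FreeGroup.norm, commonPrefixLength, h₂.reduce_eq]
  | cons x xs ih =>
    cases L₂ with
    | nil =>
      simp [← FreeGroup.one_eq_mk, FreeGroup.norm, commonPrefixLength, h₁.reduce_eq,
        -FreeGroup.inv_mk]
    | cons y ys =>
      by_cases hxy : x = y
      · subst hxy
        have key := ih (L₂ := ys) (List.IsChain.tail h₁) (List.IsChain.tail h₂)
        have : (FreeGroup.mk (x :: xs))⁻¹ * FreeGroup.mk (x :: ys) =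
            (FreeGroup.mk xs)⁻¹ * FreeGroup.mk ys := by
          rw [← List.singleton_append (l := xs), ← List.singleton_append (l := ys),
            ← FreeGroup.mul_mk, ← FreeGroup.mul_mk]
          group
        rw [this]
        simp only [commonPrefixLength, if_true, List.length_cons]
        omega
      · have hred : FreeGroup.IsReduced (FreeGroup.invRev (x :: xs) ++ y :: ys) := by
          refine List.isChain_append.2 ⟨?_, h₂, ?_⟩
          · have := FreeGroup.isReduced_toWord (x := (FreeGroup.mk (x :: xs))⁻¹)
            rwa [FreeGroup.toWord_inv, FreeGroup.toWord_mk_of_isReduced h₁] at this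
          · simp only [FreeGroup.invRev, List.map_cons, List.reverse_cons, List.getLast?_append,
              List.getLast?_singleton, List.head?_cons, Option.mem_def]
            rintro _ ⟨rfl⟩ _ ⟨rfl⟩ h
            rcases x with ⟨x, _ | _⟩ <;> rcases y with ⟨y, _ | _⟩ <;> simp_all
        rw [FreeGroup.inv_mk, FreeGroup.mul_mk, FreeGroup.norm, FreeGroup.toWord_mk_of_isReduced hred]
        simp [commonPrefixLength, hxy, FreeGroup.invRev_length]

theorem FreeGroup.norm_inv_mul (g h : FreeGroup γ) :
    (g⁻¹ * h).norm + 2 * commonPrefixLength g.toWord h.toWord = g.norm + h.norm := by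
  have := FreeGroup.norm_inv_mk_mul_mk (FreeGroup.isReduced_toWord (x := g))
    (FreeGroup.isReduced_toWord (x := h))
  rwa [FreeGroup.mk_toWord, FreeGroup.mk_toWord] at this

/-- In the Cayley tree, the geodesic from `g` to `h` lies in the union of the geodesics
from `1` to `g` and from `1` to `h`. -/
theorem FreeGroup.isPrefix_or_isPrefix_of_norm_add_norm_eq {g h k : FreeGroup γ}
    (hk : (g⁻¹ * k).norm + (k⁻¹ * h).norm = (g⁻¹ * h).norm) :
    k.toWord <+: g.toWord ∨ k.toWord <+: h.toWord := by
  have h₁ := FreeGroup.norm_inv_mul g k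
  have h₂ := FreeGroup.norm_inv_mul k h
  have h₃ := FreeGroup.norm_inv_mul g h
  have h₄ := min_commonPrefixLength_le g.toWord k.toWord h.toWord
  have hkn : k.norm = k.toWord.length := rfl
  rcases le_total (commonPrefixLength g.toWord k.toWord)
    (commonPrefixLength k.toWord h.toWord) with hle | hle
  · rw [min_eq_left hle] at h₄
    exact .inr (isPrefix_of_length_le_commonPrefixLength (by omega))
  · rw [min_eq_right hle] at h₄
    rw [commonPrefixLength_comm] at h₁ hle
    exact .inl (isPrefix_of_length_le_commonPrefixLength (by omega))

theorem FreeGroup.toWord_mul_of {g : FreeGroup γ} {x : γ}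
    (h : FreeGroup.IsReduced (g.toWord ++ [(x, true)])) :
    (g * FreeGroup.of x).toWord = g.toWord ++ [(x, true)] := by
  rw [FreeGroup.toWord_mul, FreeGroup.toWord_of, h.reduce_eq]

theorem FreeGroup.toWord_mul_of_inv {g : FreeGroup γ} {x : γ}
    (h : FreeGroup.IsReduced (g.toWord ++ [(x, false)])) :
    (g * (FreeGroup.of x)⁻¹).toWord = g.toWord ++ [(x, false)] := by
  rw [FreeGroup.toWord_mul, FreeGroup.toWord_inv, FreeGroup.toWord_of]
  exact h.reduce_eq

/-- Induction along geodesics starting at `1`. -/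
theorem FreeGroup.toWord_concat_induction {p : FreeGroup γ → Prop} (one : p 1)
    (concat : ∀ (g : FreeGroup γ) (s : γ × Bool), (g * FreeGroup.mk [s]).toWord = g.toWord ++ [s] →
      p g → p (g * FreeGroup.mk [s])) (g : FreeGroup γ) : p g := by
  suffices h : ∀ L : List (γ × Bool), FreeGroup.IsReduced L → p (FreeGroup.mk L) by
    rw [← FreeGroup.mk_toWord (x := g)]
    exact h _ FreeGroup.isReduced_toWord
  intro L
  induction L using List.reverseRecOn with
  | nil => exact fun _ => one
  | append_singleton L s ih =>
    intro hL
    have hL' : FreeGroup.IsReduced L := (List.isChain_append.1 hL).1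
    rw [← FreeGroup.mul_mk]
    refine concat _ _ ?_ (ih hL')
    rw [FreeGroup.mul_mk, FreeGroup.toWord_mk_of_isReduced hL,
      FreeGroup.toWord_mk_of_isReduced hL']

end FreeGroupNorm

section Configurations

variable {n m : ℕ}

theorem patternC1_iff {ξ : F n m → Bool} {g : F n m} :
    PatternC1 ξ g ↔
      (∀ c : Bool, ∃! x : E n m, x.isLeft = c ∧ ξ (g * FreeGroup.of x) = true) ∧
        ∀ x : E n m, ξ (g * (FreeGroup.of x)⁻¹) = false := by
  simp only [PatternC1, ExistsUnique, Bool.forall_bool, Sum.exists, Sum.forall, Sum.isLeft_inl,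
    Sum.isLeft_inr, a, b, and_assoc]
  simp
  tauto

theorem patternC2_iff {ξ : F n m → Bool} {g : F n m} :
    PatternC2 ξ g ↔
      (∀ x : E n m, ξ (g * FreeGroup.of x) = false) ∧
        ∀ x : E n m, ξ (g * (FreeGroup.of x)⁻¹) = true := by
  simp only [PatternC2, Sum.forall, a, b, and_assoc]

theorem patternC1_of_mem_mul_of {ξ : F n m → Bool} (hξ : ξ ∈ Omega n m) {g : F n m}
    (hg : ξ g = true) {x : E n m} (hx : ξ (g * FreeGroup.of x) = true) : PatternC1 ξ g := by
  refine (hξ.2.2 g hg).resolve_right fun h => ?_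
  simp [(patternC2_iff.1 h).1 x] at hx

theorem patternC2_of_mem_mul_of_inv {ξ : F n m → Bool} (hξ : ξ ∈ Omega n m) {g : F n m}
    (hg : ξ g = true) {x : E n m} (hx : ξ (g * (FreeGroup.of x)⁻¹) = true) :
    PatternC2 ξ g := by
  refine (hξ.2.2 g hg).resolve_left fun h => ?_
  simp [(patternC1_iff.1 h).2 x] at hx

theorem mem_Yu_iff {ξ : F n m → Bool} :
    ξ ∈ Yu n m ↔ ξ ∈ Omega n m ∧ ∀ x : E n m, ξ (FreeGroup.of x)⁻¹ = true := by
  simp only [Yu, a, b, Sum.forall, Set.mem_ofPred_eq]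

theorem patternC2_one {ξ : F n m → Bool} (hn : 0 < n) (hξ : ξ ∈ Yu n m) : PatternC2 ξ 1 := by
  rw [mem_Yu_iff] at hξ
  exact patternC2_of_mem_mul_of_inv hξ.1 hξ.1.1 (x := Sum.inl ⟨0, hn⟩) (by simp [hξ.2])

theorem existsUnique_mul_of_inv_mul_of {ξ : F n m → Bool} (hξ : ξ ∈ Omega n m) {g : F n m}
    (hg : ξ g = true) (hg2 : PatternC2 ξ g) (e : E n m) (c : Bool) :
    ∃! x : E n m, x.isLeft = c ∧ ξ (g * (FreeGroup.of e)⁻¹ * FreeGroup.of x) = true :=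
  (patternC1_iff.1 (patternC1_of_mem_mul_of hξ ((patternC2_iff.1 hg2).2 e)
    (x := e) (by simpa using hg))).1 c

theorem mem_of_toWord_isPrefix {ξ : F n m → Bool} (hξ : ξ ∈ Omega n m) {g k : F n m}
    (hg : ξ g = true) (hk : k.toWord <+: g.toWord) : ξ k = true := by
  refine hξ.2.1 1 g k hξ.1 hg ?_
  obtain ⟨L, hL⟩ := hk
  have hL' : FreeGroup.IsReduced L := by
    have := FreeGroup.isReduced_toWord (x := g)
    rw [← hL] at this
    exact (List.isChain_append.1 this).2.1
  have : k⁻¹ * g = FreeGroup.mk L := by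
    rw [inv_mul_eq_iff_eq_mul, ← FreeGroup.toWord_inj, FreeGroup.toWord_mul,
      FreeGroup.toWord_mk_of_isReduced hL', hL, FreeGroup.reduce_toWord]
  rw [this]
  simp [FreeGroup.norm, ← hL, -FreeGroup.toWord_mk,
    FreeGroup.toWord_mk_of_isReduced hL']

/-- A configuration of `Ω^u` is maximal: the pattern at a point dictates the neighbours. -/
theorem eq_of_forall_imp (hn : 0 < n) {η ξ : F n m → Bool} (hη : η ∈ Omega n m)
    (hξ : ξ ∈ Omega n m) (h : ∀ g, η g = true → ξ g = true) : η = ξ := by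
  suffices H : ∀ g, ξ g = true → η g = true by
    funext g
    exact Bool.eq_iff_iff.2 ⟨h g, H g⟩
  refine FreeGroup.toWord_concat_induction (fun _ => hη.1) ?_
  rintro g ⟨x, s⟩ hword ih hgs
  have hξg : ξ g = true := mem_of_toWord_isPrefix hξ hgs (by simp [hword])
  have hηg := ih hξg
  have hof : FreeGroup.mk [(x, true)] = FreeGroup.of x := rfl
  have hofinv : FreeGroup.mk [(x, false)] = (FreeGroup.of x)⁻¹ := rfl
  rcases hη.2.2 g hηg with h1 | h2
  · rw [patternC1_iff] at h1
    obtain ⟨y, ⟨hyc, hy⟩, -⟩ := h1.1 x.isLeft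
    have hξ1 := patternC1_iff.1 (patternC1_of_mem_mul_of hξ hξg (h _ hy))
    cases s
    · rw [hofinv, hξ1.2] at hgs
      cases hgs
    · rw [hof] at hgs ⊢
      rwa [(hξ1.1 x.isLeft).unique ⟨rfl, hgs⟩ ⟨hyc, h _ hy⟩]
  · rw [patternC2_iff] at h2
    have hξ2 := patternC2_iff.1
      (patternC2_of_mem_mul_of_inv hξ hξg (h _ (h2.2 (Sum.inl ⟨0, hn⟩))))
    cases s
    · exact h2.2 x
    · rw [hof, hξ2.1] at hgs
      cases hgs

end Configurations

section EFunctions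

variable {n m : ℕ}

/-- The word `x_1⁻¹ f(pre x_1) ⋯ x_r⁻¹ f(pre x_1 ⋯ x_r)` of which `fullAux f pre [x_1,…,x_r]`
is the product. -/
def letters (f : Word n m → E n m) : List (E n m) → List (E n m) → List (E n m × Bool)
  | _, [] => []
  | pre, e :: rest =>
      (e, false) :: (f ⟨pre ++ [e], ne_nil_append_singleton pre e⟩, true) ::
        letters f (pre ++ [e]) rest

theorem mk_letters (f : Word n m → E n m) (pre w : List (E n m)) :
    FreeGroup.mk (letters f pre w) = fullAux f pre w := by
  induction w generalizing pre with
  | nil => rfl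
  | cons e rest ih =>
    rw [fullAux, ← ih]
    rfl

theorem letters_append (f : Word n m → E n m) (pre u v : List (E n m)) :
    letters f pre (u ++ v) = letters f pre u ++ letters f (pre ++ u) v := by
  induction u generalizing pre with
  | nil => simp [letters]
  | cons e rest ih => simp [letters, ih]

theorem letters_concat (f : Word n m → E n m) (w : List (E n m)) (e : E n m) :
    letters f [] (w ++ [e]) =
      letters f [] w ++ [(e, false)] ++ [(f ⟨w ++ [e], ne_nil_append_singleton w e⟩, true)] := by
  simp [letters_append, letters]

theorem fullAux_concat (f : Word n m → E n m) (w : List (E n m)) (e : E n m) :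
    fullAux f [] (w ++ [e]) =
      fullAux f [] w * (FreeGroup.of e)⁻¹ *
        FreeGroup.of (f ⟨w ++ [e], ne_nil_append_singleton w e⟩) := by
  rw [← mk_letters, ← mk_letters, letters_concat, ← FreeGroup.mul_mk, ← FreeGroup.mul_mk]
  rfl

theorem length_letters (f : Word n m → E n m) (pre w : List (E n m)) :
    (letters f pre w).length = 2 * w.length := by
  induction w generalizing pre with
  | nil => rfl
  | cons e rest ih =>
    simp only [letters, List.length_cons, ih]
    omega

theorem letters_injective (f : Word n m → E n m) (pre : List (E n m)) :
    Function.Injective (letters f pre) := by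
  intro u v h
  induction u generalizing pre v with
  | nil => cases v <;> simp_all [letters]
  | cons e rest ih =>
    cases v with
    | nil => simp [letters] at h
    | cons e' rest' =>
      simp only [letters, List.cons.injEq, Prod.mk.injEq, and_true] at h
      obtain ⟨rfl, -, h⟩ := h
      rw [ih _ h]

theorem letters_congr {f f' : Word n m → E n m} {pre w : List (E n m)}
    (h : ∀ v : Word n m, v.1.length ≤ pre.length + w.length → f v = f' v) :
    letters f pre w = letters f' pre w := by
  induction w generalizing pre with
  | nil => rfl
  | cons e rest ih =>
    have h₁ := h ⟨pre ++ [e], ne_nil_append_singleton pre e⟩ (by simp)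
    have h₂ := ih (pre := pre ++ [e]) fun v hv => h v (by simp at hv ⊢; omega)
    simp only [letters, h₁, h₂]

/-- `w` is empty or belongs to one of the sets `Ω_r(f)`. -/
def Admissible (f : Word n m → E n m) (w : List (E n m)) : Prop :=
  ∀ h : w ≠ [], (⟨w, h⟩ : Word n m) ∈ EOmega f

theorem admissible_nil (f : Word n m → E n m) : Admissible f [] := fun h => absurd rfl h

theorem admissible_singleton (f : Word n m → E n m) (e : E n m) : Admissible f [e] := by
  intro _ k hk0 hk
  simp at hk
  omega

theorem admissible_concat_concat {f : Word n m → E n m} {w : List (E n m)} {e x : E n m} :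
    Admissible f (w ++ [e] ++ [x]) ↔
      Admissible f (w ++ [e]) ∧ x ≠ f ⟨w ++ [e], ne_nil_append_singleton w e⟩ := by
  constructor
  · intro h
    have h' := h (by simp)
    refine ⟨fun _ k hk0 hk => ?_, ?_⟩
    · have := h' k hk0 (by simp at hk ⊢; omega)
      simpa only [List.get_eq_getElem, List.getElem_append_left hk,
        List.take_append_of_le_length hk.le] using this
    · have := h' (w ++ [e]).length (by simp) (by simp)
      simpa only [List.get_eq_getElem, List.getElem_concat_length, List.take_left'] using this
  · rintro ⟨h, hx⟩ _ k hk0 hk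
    rcases Nat.lt_or_ge k (w ++ [e]).length with hlt | hge
    · have := h (by simp) k hk0 hlt
      simpa only [List.get_eq_getElem, List.getElem_append_left hlt,
        List.take_append_of_le_length hlt.le] using this
    · obtain rfl : k = (w ++ [e]).length := by
        simp only [List.length_append, List.length_singleton] at hk hge ⊢
        omega
      simpa only [List.get_eq_getElem, List.getElem_concat_length, List.take_left'] using hx

theorem admissible_of_concat {f : Word n m → E n m} {w : List (E n m)} {e : E n m}
    (h : Admissible f (w ++ [e])) : Admissible f w := by
  cases w using List.reverseRecOn with
  | nil => exact admissible_nil f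
  | append_singleton w x => exact (admissible_concat_concat.1 h).1

theorem admissible_congr {f f' : Word n m → E n m} {w : List (E n m)}
    (h : ∀ v : Word n m, v.1.length ≤ w.length → f v = f' v) (hw : Admissible f w) :
    Admissible f' w := by
  intro hne k hk0 hk
  rw [← h _ (by simp)]
  exact hw hne k hk0 hk

theorem mem_psiSet_iff_fullAux {f : Word n m → E n m} {g : F n m} :
    g ∈ psiSet f ↔ (∃ w, Admissible f w ∧ g = fullAux f [] w) ∨
      ∃ w e, Admissible f (w ++ [e]) ∧ g = fullAux f [] w * (FreeGroup.of e)⁻¹ := by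
  constructor
  · rintro (rfl | ⟨⟨w, hne⟩, hw, hg | hg⟩)
    · exact .inl ⟨[], admissible_nil f, rfl⟩
    · refine .inr ⟨w.dropLast, w.getLast hne, ?_, hg⟩
      rw [List.dropLast_append_getLast]
      exact fun _ => hw
    · exact .inl ⟨w, fun _ => hw, hg⟩
  · rintro (⟨w, hw, rfl⟩ | ⟨w, e, hw, rfl⟩)
    · by_cases hne : w = []
      · subst hne
        exact .inl rfl
      · exact .inr ⟨⟨w, hne⟩, hw hne, .inr rfl⟩
    · exact .inr ⟨⟨w ++ [e], by simp⟩, hw (by simp), .inl (by simp)⟩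

theorem isReduced_letters {f : Word n m → E n m} (hf : f ∈ Zset n m) {w : List (E n m)}
    (hw : Admissible f w) : FreeGroup.IsReduced (letters f [] w) := by
  induction w using List.reverseRecOn with
  | nil => exact List.isChain_nil
  | append_singleton w e ih =>
    rw [letters_concat, FreeGroup.isReduced_concat_iff]
    constructor
    · cases w using List.reverseRecOn with
      | nil => exact List.isChain_singleton _
      | append_singleton w x =>
        obtain ⟨hw', hx⟩ := admissible_concat_concat.1 hw
        have := ih hw'
        rw [letters_concat] at this ⊢
        exact FreeGroup.isReduced_concat_iff.2 ⟨this, fun h => absurd h.symm hx⟩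
    · intro h
      have := hf ⟨w ++ [e], ne_nil_append_singleton w e⟩
      simp only [colorOK, List.getLast_append_singleton] at this h
      rw [← h] at this
      exact absurd this (Bool.self_ne_not _)

theorem isReduced_letters_concat {f : Word n m → E n m} (hf : f ∈ Zset n m) {w : List (E n m)}
    {e : E n m} (hw : Admissible f (w ++ [e])) :
    FreeGroup.IsReduced (letters f [] w ++ [(e, false)]) := by
  have := isReduced_letters hf hw
  rw [letters_concat] at this
  exact (FreeGroup.isReduced_concat_iff.1 this).1

theorem mem_psiSet_iff {f : Word n m → E n m} (hf : f ∈ Zset n m) {g : F n m} :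
    g ∈ psiSet f ↔ (∃ w, Admissible f w ∧ g.toWord = letters f [] w) ∨
      ∃ w e, Admissible f (w ++ [e]) ∧ g.toWord = letters f [] w ++ [(e, false)] := by
  rw [mem_psiSet_iff_fullAux]
  have h₁ : ∀ w, Admissible f w → (g = fullAux f [] w ↔ g.toWord = letters f [] w) := by
    intro w hw
    rw [← FreeGroup.toWord_inj, ← mk_letters,
      FreeGroup.toWord_mk_of_isReduced (isReduced_letters hf hw)]
  have h₂ : ∀ w e, Admissible f (w ++ [e]) → (g = fullAux f [] w * (FreeGroup.of e)⁻¹ ↔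
      g.toWord = letters f [] w ++ [(e, false)]) := by
    intro w e hw
    have : fullAux f [] w * (FreeGroup.of e)⁻¹ =
        FreeGroup.mk (letters f [] w ++ [(e, false)]) := by
      rw [← FreeGroup.mul_mk, mk_letters]
      rfl
    rw [this, ← FreeGroup.toWord_inj,
      FreeGroup.toWord_mk_of_isReduced (isReduced_letters_concat hf hw)]
  constructor
  · rintro (⟨w, hw, h⟩ | ⟨w, e, hw, h⟩)
    · exact .inl ⟨w, hw, (h₁ w hw).1 h⟩
    · exact .inr ⟨w, e, hw, (h₂ w e hw).1 h⟩
  · rintro (⟨w, hw, h⟩ | ⟨w, e, hw, h⟩)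
    · exact .inl ⟨w, hw, (h₁ w hw).2 h⟩
    · exact .inr ⟨w, e, hw, (h₂ w e hw).2 h⟩

theorem psiB_eq_true {f : Word n m → E n m} {g : F n m} : psiB f g = true ↔ g ∈ psiSet f := by
  simp [psiB]

theorem psiB_eq_false {f : Word n m → E n m} {g : F n m} : psiB f g = false ↔ g ∉ psiSet f := by
  simp [psiB]

theorem mem_psiSet_of_isPrefix {f : Word n m → E n m} (hf : f ∈ Zset n m) {g k : F n m}
    (hg : g ∈ psiSet f) (hk : k.toWord <+: g.toWord) : k ∈ psiSet f := by
  obtain ⟨L, hL⟩ := hk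
  induction L using List.reverseRecOn generalizing g with
  | nil =>
    rw [List.append_nil, FreeGroup.toWord_inj] at hL
    rwa [hL]
  | append_singleton L s ih =>
    rw [← List.append_assoc] at hL
    have hred : FreeGroup.IsReduced (k.toWord ++ L) := by
      have := FreeGroup.isReduced_toWord (x := g)
      rw [← hL] at this
      exact (List.isChain_append.1 this).1
    have hword := FreeGroup.toWord_mk_of_isReduced hred
    refine ih (g := FreeGroup.mk (k.toWord ++ L)) ?_ hword.symm
    rw [mem_psiSet_iff hf] at hg ⊢
    rw [hword]
    rw [← hL] at hg
    rcases hg with ⟨w, hw, h⟩ | ⟨w, e, hw, h⟩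
    · cases w using List.reverseRecOn with
      | nil => simp [letters] at h
      | append_singleton w e =>
        rw [letters_concat] at h
        exact .inr ⟨w, e, hw, (List.append_inj' h rfl).1⟩
    · exact .inl ⟨w, admissible_of_concat hw, (List.append_inj' h rfl).1⟩

theorem isConvexCfg_psiB {f : Word n m → E n m} (hf : f ∈ Zset n m) : IsConvexCfg (psiB f) := by
  intro g h k hg hh hk
  rw [psiB_eq_true] at *
  rcases FreeGroup.isPrefix_or_isPrefix_of_norm_add_norm_eq hk with hp | hp
  · exact mem_psiSet_of_isPrefix hf hg hp
  · exact mem_psiSet_of_isPrefix hf hh hp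

theorem patternC2_psiB {f : Word n m → E n m} (hf : f ∈ Zset n m) {w : List (E n m)}
    (hw : Admissible f w) : PatternC2 (psiB f) (fullAux f [] w) := by
  have hword : (fullAux f [] w).toWord = letters f [] w := by
    rw [← mk_letters, FreeGroup.toWord_mk_of_isReduced (isReduced_letters hf hw)]
  refine patternC2_iff.2 ⟨fun x => ?_, fun x => ?_⟩
  · have hred : FreeGroup.IsReduced (letters f [] w ++ [(x, true)]) := by
      have := isReduced_letters hf hw
      cases w using List.reverseRecOn with
      | nil => exact List.isChain_singleton _
      | append_singleton w e =>
        rw [letters_concat] at this ⊢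
        exact FreeGroup.isReduced_concat_iff.2 ⟨this, fun _ => rfl⟩
    rw [psiB_eq_false, mem_psiSet_iff hf,
      FreeGroup.toWord_mul_of (by rwa [hword]), hword]
    rintro (⟨v, -, h⟩ | ⟨v, e, -, h⟩)
    · have := congrArg List.length h
      simp only [List.length_append, length_letters, List.length_singleton] at this
      omega
    · simpa using (List.append_inj' h rfl).2
  · rw [psiB_eq_true, mem_psiSet_iff_fullAux]
    by_cases hx : Admissible f (w ++ [x])
    · exact .inr ⟨w, x, hx, rfl⟩
    · cases w using List.reverseRecOn with
      | nil => exact absurd (admissible_singleton f x) hx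
      | append_singleton w e =>
        obtain rfl : x = _ := not_not.1 fun h => hx (admissible_concat_concat.2 ⟨hw, h⟩)
        refine .inr ⟨w, e, hw, ?_⟩
        rw [fullAux_concat, mul_inv_cancel_right]

theorem patternC1_psiB {f : Word n m → E n m} (hf : f ∈ Zset n m) {w : List (E n m)} {e : E n m}
    (hw : Admissible f (w ++ [e])) :
    PatternC1 (psiB f) (fullAux f [] w * (FreeGroup.of e)⁻¹) := by
  have hmk : fullAux f [] w * (FreeGroup.of e)⁻¹ =
      FreeGroup.mk (letters f [] w ++ [(e, false)]) := by
    rw [← FreeGroup.mul_mk, mk_letters]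
    rfl
  have hred := isReduced_letters_concat hf hw
  have hword : (fullAux f [] w * (FreeGroup.of e)⁻¹).toWord = letters f [] w ++ [(e, false)] := by
    rw [hmk, FreeGroup.toWord_mk_of_isReduced hred]
  have key : ∀ x : E n m, psiB f (fullAux f [] w * (FreeGroup.of e)⁻¹ * FreeGroup.of x) = true ↔
      x = e ∨ x = f ⟨w ++ [e], ne_nil_append_singleton w e⟩ := by
    intro x
    rw [psiB_eq_true]
    constructor
    · intro h
      by_contra! hx
      rw [mem_psiSet_iff hf, FreeGroup.toWord_mul_of
        (by
          rw [hword]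
          exact FreeGroup.isReduced_concat_iff.2 ⟨hred, fun h => absurd h.symm hx.1⟩), hword] at h
      rcases h with ⟨v, -, h⟩ | ⟨v, y, -, h⟩
      · cases v using List.reverseRecOn with
        | nil => simp [letters] at h
        | append_singleton v y =>
          rw [letters_concat] at h
          obtain ⟨h₁, h₂⟩ := List.append_inj' h rfl
          obtain ⟨h₃, h₄⟩ := List.append_inj' h₁ rfl
          obtain rfl := letters_injective f [] h₃
          simp only [List.cons.injEq, Prod.mk.injEq, and_true] at h₂ h₄
          subst h₄
          exact hx.2 h₂
      · simpa using (List.append_inj' h rfl).2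
    · rw [mem_psiSet_iff_fullAux]
      rintro (rfl | rfl)
      · exact .inl ⟨w, admissible_of_concat hw, by simp⟩
      · exact .inl ⟨w ++ [e], hw, (fullAux_concat f w e).symm⟩
  have hcolor : (f ⟨w ++ [e], ne_nil_append_singleton w e⟩).isLeft = !e.isLeft := by
    simpa only [colorOK, List.getLast_append_singleton] using
      hf ⟨w ++ [e], ne_nil_append_singleton w e⟩
  refine patternC1_iff.2 ⟨fun c => ?_, fun x => ?_⟩
  · simp only [key]
    by_cases hc : e.isLeft = c
    · refine ⟨e, ⟨hc, .inl rfl⟩, ?_⟩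
      rintro y ⟨hy, rfl | rfl⟩
      · rfl
      · rw [hcolor, ← hc] at hy
        exact absurd hy (Bool.not_ne_self _)
    · refine ⟨_, ⟨?_, .inr rfl⟩, ?_⟩
      · rw [hcolor]
        exact (Bool.eq_not.2 (Ne.symm hc)).symm
      · rintro y ⟨hy, rfl | rfl⟩
        · exact absurd hy hc
        · rfl
  · rw [psiB_eq_false, mem_psiSet_iff hf, FreeGroup.toWord_mul_of_inv
      (by
        rw [hword]
        exact FreeGroup.isReduced_concat_iff.2 ⟨hred, fun _ => rfl⟩), hword]
    rintro (⟨v, -, h⟩ | ⟨v, y, -, h⟩)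
    · cases v using List.reverseRecOn with
      | nil => simp [letters] at h
      | append_singleton v y =>
        rw [letters_concat] at h
        simpa using (List.append_inj' h rfl).2
    · have := congrArg List.length h
      simp only [List.length_append, length_letters, List.length_singleton] at this
      omega

theorem psiB_mem_Yu {f : Word n m → E n m} (hf : f ∈ Zset n m) : psiB f ∈ Yu n m := by
  have h1 : psiB f 1 = true := psiB_eq_true.2 (.inl rfl)
  rw [mem_Yu_iff]
  refine ⟨⟨h1, isConvexCfg_psiB hf, fun g hg => ?_⟩, fun x => ?_⟩
  · rw [psiB_eq_true, mem_psiSet_iff_fullAux] at hg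
    rcases hg with ⟨w, hw, rfl⟩ | ⟨w, e, hw, rfl⟩
    · exact .inr (patternC2_psiB hf hw)
    · exact .inl (patternC1_psiB hf hw)
  · simpa [fullAux] using (patternC2_iff.1 (patternC2_psiB hf (admissible_nil f))).2 x

/-- Up to cancelling the pairs `e f(α e)`, every word is admissible. -/
theorem exists_admissible_of_mem_Dset {f : Word n m → E n m} (hf : f ∈ Dset n m)
    (w : List (E n m)) :
    ∃ v, Admissible f v ∧ fullAux f [] w = fullAux f [] v ∧
      ∀ u : Word n m, f ⟨w ++ u.1, ne_nil_append _ u.2⟩ = f ⟨v ++ u.1, ne_nil_append _ u.2⟩ := by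
  obtain ⟨-, hstar, hstarstar⟩ := hf
  induction w using List.reverseRecOn with
  | nil => exact ⟨[], admissible_nil f, rfl, fun _ => rfl⟩
  | append_singleton w e ih =>
    obtain ⟨v, hv, hpos, hval⟩ := ih
    have he := hval ⟨[e], by simp⟩
    have hu : ∀ u : Word n m, f ⟨w ++ [e] ++ u.1, ne_nil_append _ u.2⟩ =
        f ⟨v ++ [e] ++ u.1, ne_nil_append _ u.2⟩ := fun u => by
      simpa only [List.append_assoc] using hval ⟨[e] ++ u.1, by simp⟩
    by_cases had : Admissible f (v ++ [e])
    · refine ⟨v ++ [e], had, ?_, hu⟩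
      rw [fullAux_concat, fullAux_concat, hpos, he]
    · cases v using List.reverseRecOn with
      | nil => exact absurd (admissible_singleton f e) had
      | append_singleton v x =>
        have hex : e = f ⟨v ++ [x], ne_nil_append_singleton v x⟩ :=
          not_not.1 fun h => had (admissible_concat_concat.2 ⟨hv, h⟩)
        have hcancel : f ⟨v ++ [x] ++ [e], ne_nil_append_singleton _ _⟩ = x := by
          simpa only [← hex] using hstar v x
        refine ⟨v, admissible_of_concat hv, ?_, fun u => ?_⟩
        · rw [fullAux_concat, hpos, he, hcancel, fullAux_concat, ← hex]
          simp
        · rw [hu u]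
          simpa only [← hex] using hstarstar v x u

theorem fullAux_mem_psiSet {f : Word n m → E n m} (hf : f ∈ Dset n m) (w : List (E n m)) :
    fullAux f [] w ∈ psiSet f := by
  obtain ⟨v, hv, h, -⟩ := exists_admissible_of_mem_Dset hf w
  exact mem_psiSet_iff_fullAux.2 (.inl ⟨v, hv, h⟩)

theorem mem_psiSet_congr {f f' : Word n m → E n m} (hf : f ∈ Zset n m) {g : F n m}
    (h : ∀ v : Word n m, v.1.length ≤ g.norm → f v = f' v) (hg : g ∈ psiSet f) :
    g ∈ psiSet f' := by
  have hnorm : g.norm = g.toWord.length := rfl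
  rw [mem_psiSet_iff hf] at hg
  rw [mem_psiSet_iff_fullAux]
  rcases hg with ⟨w, hw, hgw⟩ | ⟨w, e, hw, hgw⟩
  · rw [hgw, length_letters] at hnorm
    refine .inl ⟨w, admissible_congr (fun v hv => h v (by omega)) hw, ?_⟩
    rw [← mk_letters, ← letters_congr (f := f) fun v hv => h v (by simp at hv; omega), ← hgw,
      FreeGroup.mk_toWord]
  · rw [hgw, List.length_append, length_letters, List.length_singleton] at hnorm
    refine .inr ⟨w, e, admissible_congr (fun v hv => h v ?_) hw, ?_⟩
    · simp only [List.length_append, List.length_singleton] at hv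
      omega
    · rw [← mk_letters, ← letters_congr (f := f) fun v hv => h v (by simp at hv; omega),
        ← FreeGroup.mk_toWord (x := g), hgw, ← FreeGroup.mul_mk]
      rfl

end EFunctions

section Inverse

variable {n m : ℕ}

open Classical in
/-- For `g ∈ ξ` of pattern (c2), the generator `x` of the color opposite to `e` such that
`g e⁻¹ x ∈ ξ`. -/
noncomputable def nextLetter (ξ : F n m → Bool) (g : F n m) (e : E n m) : E n m :=
  if h : ∃ x : E n m, x.isLeft = !e.isLeft ∧
      ξ (g * (FreeGroup.of e)⁻¹ * FreeGroup.of x) = true then h.choose else e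

/-- The endpoint of the walk in `ξ` starting at `1` and prescribed by a word over `E`. -/
noncomputable def walk (ξ : F n m → Bool) (w : List (E n m)) : F n m :=
  w.foldl (fun g e => g * (FreeGroup.of e)⁻¹ * FreeGroup.of (nextLetter ξ g e)) 1

/-- The function `E^+ → E` recording the letters met along the walks in `ξ`. -/
noncomputable def ofConfig (ξ : F n m → Bool) (w : Word n m) : E n m :=
  nextLetter ξ (walk ξ w.1.dropLast) (w.1.getLast w.2)

theorem walk_concat (ξ : F n m → Bool) (w : List (E n m)) (e : E n m) :
    walk ξ (w ++ [e]) =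
      walk ξ w * (FreeGroup.of e)⁻¹ * FreeGroup.of (nextLetter ξ (walk ξ w) e) := by
  simp [walk]

theorem ofConfig_concat (ξ : F n m → Bool) (w : List (E n m)) (e : E n m) :
    ofConfig ξ ⟨w ++ [e], ne_nil_append_singleton w e⟩ = nextLetter ξ (walk ξ w) e := by
  simp [ofConfig]

theorem fullAux_ofConfig (ξ : F n m → Bool) (w : List (E n m)) :
    fullAux (ofConfig ξ) [] w = walk ξ w := by
  induction w using List.reverseRecOn with
  | nil => rfl
  | append_singleton w e ih => rw [fullAux_concat, ih, ofConfig_concat, walk_concat]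

theorem nextLetter_spec {ξ : F n m → Bool} (hξ : ξ ∈ Omega n m) {g : F n m} (hg : ξ g = true)
    (hg2 : PatternC2 ξ g) (e : E n m) :
    (nextLetter ξ g e).isLeft = (!e.isLeft) ∧
      ξ (g * (FreeGroup.of e)⁻¹ * FreeGroup.of (nextLetter ξ g e)) = true := by
  have h := (existsUnique_mul_of_inv_mul_of hξ hg hg2 e (!e.isLeft)).exists
  rw [nextLetter, dif_pos h]
  exact h.choose_spec

theorem nextLetter_eq {ξ : F n m → Bool} (hξ : ξ ∈ Omega n m) {g : F n m} (hg : ξ g = true)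
    (hg2 : PatternC2 ξ g) {e x : E n m} (hx : x.isLeft = !e.isLeft)
    (hgx : ξ (g * (FreeGroup.of e)⁻¹ * FreeGroup.of x) = true) : nextLetter ξ g e = x :=
  (existsUnique_mul_of_inv_mul_of hξ hg hg2 e (!e.isLeft)).unique
    (nextLetter_spec hξ hg hg2 e) ⟨hx, hgx⟩

theorem walk_mem {ξ : F n m → Bool} (hn : 0 < n) (hξ : ξ ∈ Yu n m) (w : List (E n m)) :
    ξ (walk ξ w) = true ∧ PatternC2 ξ (walk ξ w) := by
  induction w using List.reverseRecOn with
  | nil => exact ⟨hξ.1.1, patternC2_one hn hξ⟩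
  | append_singleton w e ih =>
    have h := (nextLetter_spec hξ.1 ih.1 ih.2 e).2
    rw [walk_concat]
    refine ⟨h, patternC2_of_mem_mul_of_inv hξ.1 h (x := nextLetter ξ (walk ξ w) e) ?_⟩
    rw [mul_inv_cancel_right]
    exact (patternC2_iff.1 ih.2).2 e

theorem nextLetter_walk_concat {ξ : F n m → Bool} (hn : 0 < n) (hξ : ξ ∈ Yu n m)
    (w : List (E n m)) (e : E n m) :
    nextLetter ξ (walk ξ (w ++ [e])) (nextLetter ξ (walk ξ w) e) = e := by
  have h := walk_mem hn hξ w
  have h' := walk_mem hn hξ (w ++ [e])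
  refine nextLetter_eq hξ.1 h'.1 h'.2 ?_ ?_
  · simp [(nextLetter_spec hξ.1 h.1 h.2 e).1]
  · simpa [walk_concat] using h.1

theorem walk_concat_nextLetter {ξ : F n m → Bool} (hn : 0 < n) (hξ : ξ ∈ Yu n m)
    (w : List (E n m)) (e : E n m) :
    walk ξ (w ++ [e] ++ [nextLetter ξ (walk ξ w) e]) = walk ξ w := by
  rw [walk_concat ξ (w ++ [e]), nextLetter_walk_concat hn hξ, walk_concat]
  simp

theorem walk_append_congr {ξ : F n m → Bool} {w v : List (E n m)} (h : walk ξ w = walk ξ v)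
    (u : List (E n m)) : walk ξ (w ++ u) = walk ξ (v ++ u) := by
  unfold walk at *
  rw [List.foldl_append, List.foldl_append, h]

theorem ofConfig_mem_Dset {ξ : F n m → Bool} (hn : 0 < n) (hξ : ξ ∈ Yu n m) :
    ofConfig ξ ∈ Dset n m := by
  refine ⟨fun w => ?_, fun w e => ?_, fun w e u => ?_⟩
  · have h := walk_mem hn hξ w.1.dropLast
    exact (nextLetter_spec hξ.1 h.1 h.2 _).1
  · rw [ofConfig_concat, ofConfig_concat, nextLetter_walk_concat hn hξ]
  · rcases u with ⟨u, hu⟩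
    obtain ⟨u, x, rfl⟩ := (List.eq_nil_or_concat' u).resolve_left hu
    simp only [ofConfig_concat, ← List.append_assoc _ u]
    rw [walk_append_congr (walk_concat_nextLetter hn hξ w e)]

theorem psiB_ofConfig {ξ : F n m → Bool} (hn : 0 < n) (hξ : ξ ∈ Yu n m) :
    psiB (ofConfig ξ) = ξ := by
  refine eq_of_forall_imp hn (psiB_mem_Yu (ofConfig_mem_Dset hn hξ).1).1 hξ.1 fun g hg => ?_
  rw [psiB_eq_true, mem_psiSet_iff_fullAux] at hg
  rcases hg with ⟨w, -, rfl⟩ | ⟨w, e, -, rfl⟩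
  · rw [fullAux_ofConfig]
    exact (walk_mem hn hξ w).1
  · rw [fullAux_ofConfig]
    exact (patternC2_iff.1 (walk_mem hn hξ w).2).2 e

theorem ofConfig_psiB {f : Word n m → E n m} (hn : 0 < n) (hf : f ∈ Dset n m) :
    ofConfig (psiB f) = f := by
  have hY := psiB_mem_Yu hf.1
  have hstep : ∀ w e, walk (psiB f) w = fullAux f [] w →
      nextLetter (psiB f) (walk (psiB f) w) e = f ⟨w ++ [e], ne_nil_append_singleton w e⟩ := by
    intro w e hw
    have h := walk_mem hn hY w
    refine nextLetter_eq hY.1 h.1 h.2 ?_ ?_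
    · simpa only [colorOK, List.getLast_append_singleton] using
        hf.1 ⟨w ++ [e], ne_nil_append_singleton w e⟩
    · rw [hw, ← fullAux_concat, psiB_eq_true]
      exact fullAux_mem_psiSet hf _
  have hwalk : ∀ w, walk (psiB f) w = fullAux f [] w := by
    intro w
    induction w using List.reverseRecOn with
    | nil => rfl
    | append_singleton w e ih => rw [walk_concat, hstep w e ih, ih, fullAux_concat]
  funext ⟨w, hw⟩
  obtain ⟨w, e, rfl⟩ := (List.eq_nil_or_concat' w).resolve_left hw
  rw [ofConfig_concat, hstep w e (hwalk w)]

end Inverse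

section Topology

variable {n m : ℕ}

theorem isClosed_Dset : IsClosed (Dset n m) := by
  have hZ : IsClosed (Zset n m) := by
    have : Zset n m = ⋂ w : Word n m, (fun f => f w) ⁻¹' {e | colorOK w e} := by
      ext f
      simp [Zset]
    rw [this]
    exact isClosed_iInter fun w => (isClosed_discrete _).preimage (continuous_apply w)
  have hclopen : ∀ (w : Word n m) (x : E n m), IsClopen {f : Word n m → E n m | f w = x} :=
    fun w x => (isClopen_discrete {x}).preimage (continuous_apply w)
  have hstar : IsClosed {f : Word n m → E n m | starCond f} := by
    have : {f : Word n m → E n m | starCond f} = ⋂ (w : List (E n m)) (e : E n m) (x : E n m),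
        {f | f ⟨w ++ [e], ne_nil_append_singleton w e⟩ = x →
          f ⟨w ++ [e] ++ [x], ne_nil_append_singleton _ _⟩ = e} := by
      ext f
      simp [starCond]
    rw [this]
    exact isClosed_iInter fun w => isClosed_iInter fun e => isClosed_iInter fun x =>
      isClosed_imp (hclopen _ _).isOpen (hclopen _ _).isClosed
  have hstarstar : IsClosed {f : Word n m → E n m | starStarCond f} := by
    have : {f : Word n m → E n m | starStarCond f} =
        ⋂ (w : List (E n m)) (e : E n m) (u : Word n m) (x : E n m),
        {f | f ⟨w ++ [e], ne_nil_append_singleton w e⟩ = x →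
          f ⟨w ++ [e] ++ [x] ++ u.1, ne_nil_append _ u.2⟩ =
            f ⟨w ++ u.1, ne_nil_append _ u.2⟩} := by
      ext f
      simp [starStarCond]
    rw [this]
    exact isClosed_iInter fun w => isClosed_iInter fun e => isClosed_iInter fun u =>
      isClosed_iInter fun x => isClosed_imp (hclopen _ _).isOpen
        (isClosed_eq (continuous_apply _) (continuous_apply _))
  exact hZ.inter (hstar.inter hstarstar)

theorem continuous_psiB : Continuous fun f : ↥(Dset n m) => psiB (f : Word n m → E n m) := by
  refine continuous_pi fun g => (IsLocallyConstant.iff_eventually_eq _).2 (fun f => ?_) |>.continuous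
  have hfin : {v : Word n m | v.1.length ≤ g.norm}.Finite :=
    (List.finite_length_le (E n m) g.norm).preimage Subtype.val_injective.injOn
  have hev : ∀ᶠ f' : ↥(Dset n m) in nhds f,
      ∀ v ∈ {v : Word n m | v.1.length ≤ g.norm}, f'.1 v = f.1 v := by
    rw [Filter.eventually_all_finite hfin]
    intro v _
    have hc : Continuous fun f' : ↥(Dset n m) => f'.1 v :=
      (continuous_apply v).comp continuous_subtype_val
    exact ((hc.tendsto f).eventually (mem_nhds_discrete.2 rfl)).mono fun _ h => h.symm
  filter_upwards [hev] with f' hf'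
  rw [Bool.eq_iff_iff, psiB_eq_true, psiB_eq_true]
  exact ⟨mem_psiSet_congr f'.2.1 hf', mem_psiSet_congr f.2.1 fun v hv => (hf' v hv).symm⟩

end Topology

/-- `ψ` is a bijection of `D` onto `Y^u` which is moreover a
homeomorphism (each space carrying its subspace topology). -/
theorem stmt_9 (n m : ℕ) (hn : 0 < n) (hm : 0 < m) :
    ∃ h : ↥(Dset n m) ≃ₜ ↥(Yu n m),
      ∀ f : ↥(Dset n m), (h f : F n m → Bool) = psiB (f : Word n m → E n m) := by
  have : CompactSpace ↥(Dset n m) := isCompact_iff_compactSpace.1 isClosed_Dset.isCompact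
  let e : ↥(Dset n m) ≃ ↥(Yu n m) :=
    { toFun := fun f => ⟨psiB f.1, psiB_mem_Yu f.2.1⟩
      invFun := fun ξ => ⟨ofConfig ξ.1, ofConfig_mem_Dset hn ξ.2⟩
      left_inv := fun f => Subtype.ext (ofConfig_psiB hn f.2)
      right_inv := fun ξ => Subtype.ext (psiB_ofConfig hn ξ.2) }
  have he : Continuous e := continuous_psiB.subtype_mk _
  exact ⟨he.homeoOfEquivCompactToT2, fun _ => rfl⟩
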